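/- arXiv:2404.01227 — 2 statements merged into one kernel-verified Lean document; each statement's English description precedes it below -/
import Mathlib

section
/- Suppose in addition that J is an idempotent (J∘J = J), that J(n(X, J(Y))) = 0 for all X, Y ∈ M, and that B ∈ M satisfies J(B) = 0 and 3·j·γ·‖B‖ < 1. Define Φ₂ : M → M by Φ₂(X) = m(B, X) − n(X, J(m(B, X))) + B (in operator form, Φ₂(X) = BΓX − (ΓX)J(BΓX) + B). Then Φ₂ has a fixed point X* with ‖X* − B‖ ≤ 2‖B‖, and this fixed point is unique in the closed ball {X ∈ M : ‖X − B‖ ≤ 2‖B‖}. (Fixed-point part of Theorem 3.3, the case JB = 0 of the method of similar operators.) -/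
/-- Banach's fixed point theorem on a closed ball, with uniqueness. -/
theorem exists_unique_fixedPoint_closedBall {E : Type*} [NormedAddCommGroup E] [CompleteSpace E]
    {f : E → E} {c : E} {r K : ℝ} (hr : 0 ≤ r) (hK0 : 0 ≤ K) (hK1 : K < 1)
    (hmaps : ∀ x, ‖x - c‖ ≤ r → ‖f x - c‖ ≤ r)
    (hlip : ∀ x y, ‖x - c‖ ≤ r → ‖y - c‖ ≤ r → ‖f x - f y‖ ≤ K * ‖x - y‖) :
    ∃ x, (‖x - c‖ ≤ r ∧ f x = x) ∧ ∀ y, ‖y - c‖ ≤ r → f y = y → y = x := by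
  have hmaps' : Set.MapsTo f (Metric.closedBall c r) (Metric.closedBall c r) := fun x hx => by
    rw [mem_closedBall_iff_norm] at hx ⊢
    exact hmaps x hx
  have hcontr : ContractingWith ⟨K, hK0⟩ (hmaps'.restrict f _ _) := by
    refine ⟨by exact_mod_cast hK1, LipschitzWith.of_dist_le_mul fun x y => ?_⟩
    rw [Subtype.dist_eq, Subtype.dist_eq, dist_eq_norm, dist_eq_norm]
    exact hlip x y (mem_closedBall_iff_norm.1 x.2) (mem_closedBall_iff_norm.1 y.2)
  obtain ⟨x, hx, hfx, -⟩ := hcontr.exists_fixedPoint' Metric.isClosed_closedBall.isComplete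
    hmaps' (Metric.mem_closedBall_self hr) (edist_ne_top c (f c))
  rw [mem_closedBall_iff_norm] at hx
  refine ⟨x, ⟨hx, hfx⟩, fun y hy hfy => ?_⟩
  have h := hlip y x hy hx
  rw [hfy, hfx.eq] at h
  have h0 : ‖y - x‖ = 0 := by nlinarith [norm_nonneg (y - x)]
  exact sub_eq_zero.1 (norm_eq_zero.1 h0)

/-- Fixed-point part of Theorem 3.3 of the paper (the case `JB = 0` of the method of
similar operators): with `J` idempotent, `J((ΓX)(JY)) = 0`, `JB = 0`, and `3jγ‖B‖ < 1`,
the map `Φ₂(X) = BΓX − (ΓX)J(BΓX) + B` has a fixed point `X*` with `‖X* − B‖ ≤ 2‖B‖`,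
unique in the ball of radius `2‖B‖` around `B`.  Here `m(X,Y) = XΓY`, `n(X,Y) = (ΓX)Y`. -/
theorem stmt2 {M : Type*} [NormedAddCommGroup M] [NormedSpace ℂ M] [CompleteSpace M]
    (γ : ℝ) (hγ : 0 < γ)
    (m n : M →ₗ[ℂ] M →ₗ[ℂ] M)
    (hm : ∀ X Y : M, ‖m X Y‖ ≤ γ * ‖X‖ * ‖Y‖)
    (hn : ∀ X Y : M, ‖n X Y‖ ≤ γ * ‖X‖ * ‖Y‖)
    (J : M →L[ℂ] M)
    (hJidem : ∀ Y : M, J (J Y) = J Y)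
    (hJn : ∀ X Y : M, J (n X (J Y)) = 0)
    (B : M)
    (hJB : J B = 0)
    (hB : 3 * max 1 ‖J‖ * γ * ‖B‖ < 1) :
    ∃ Xs : M, (‖Xs - B‖ ≤ 2 * ‖B‖ ∧ m B Xs - n Xs (J (m B Xs)) + B = Xs) ∧
      ∀ Y : M, ‖Y - B‖ ≤ 2 * ‖B‖ → m B Y - n Y (J (m B Y)) + B = Y → Y = Xs := by
  set j : ℝ := max 1 ‖J‖
  have hj1 : 1 ≤ j := le_max_left _ _
  have hb := norm_nonneg B
  have hball : ∀ X : M, ‖X - B‖ ≤ 2 * ‖B‖ → ‖X‖ ≤ 3 * ‖B‖ := fun X hX => by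
    linarith [norm_le_norm_sub_add X B]
  set a : ℝ := γ * ‖B‖ with ha
  have ha0 : 0 ≤ a := by positivity
  have hja : 3 * (j * a) < 1 := by rw [ha]; linarith
  have ha1 : 3 * a < 1 := by nlinarith
  have hja2 : 3 * (j * a) * a ≤ a := mul_le_of_le_one_left ha0 hja.le
  have hJm : ∀ X : M, ‖J (m B X)‖ ≤ j * (a * ‖X‖) := fun X =>
    (J.le_opNorm _).trans (by gcongr; exacts [le_max_right _ _, hm B X])
  have hnJm : ∀ X Y : M, ‖n X (J (m B Y))‖ ≤ γ * ‖X‖ * (j * (a * ‖Y‖)) := fun X Y =>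
    (hn _ _).trans (by gcongr; exact hJm Y)
  refine exists_unique_fixedPoint_closedBall (f := fun X => m B X - n X (J (m B X)) + B)
    (by positivity) (by positivity : 0 ≤ 3 * a) ha1 (fun X hX => ?_) fun X Y hX hY => ?_
  · have hX3 := hball X hX
    rw [add_sub_cancel_right]
    calc ‖m B X - n X (J (m B X))‖ ≤ ‖m B X‖ + ‖n X (J (m B X))‖ := norm_sub_le _ _
      _ ≤ a * ‖X‖ + γ * ‖X‖ * (j * (a * ‖X‖)) := add_le_add (hm B X) (hnJm X X)
      _ ≤ a * (3 * ‖B‖) + γ * (3 * ‖B‖) * (j * (a * (3 * ‖B‖))) := by gcongr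
      _ = (3 * a + 3 * (3 * (j * a) * a)) * ‖B‖ := by rw [ha]; ring
      _ ≤ 2 * ‖B‖ := by gcongr; linarith
  · have hX3 := hball X hX
    have hY3 := hball Y hY
    have hdiff : m B X - n X (J (m B X)) + B - (m B Y - n Y (J (m B Y)) + B) =
        m B (X - Y) - n (X - Y) (J (m B X)) - n Y (J (m B (X - Y))) := by
      simp only [map_sub, LinearMap.sub_apply]
      abel
    rw [hdiff]
    calc ‖m B (X - Y) - n (X - Y) (J (m B X)) - n Y (J (m B (X - Y)))‖
        ≤ ‖m B (X - Y)‖ + ‖n (X - Y) (J (m B X))‖ + ‖n Y (J (m B (X - Y)))‖ :=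
          (norm_sub_le _ _).trans (by gcongr; exact norm_sub_le _ _)
      _ ≤ a * ‖X - Y‖ + γ * ‖X - Y‖ * (j * (a * ‖X‖)) + γ * ‖Y‖ * (j * (a * ‖X - Y‖)) :=
          add_le_add (add_le_add (hm _ _) (hnJm _ _)) (hnJm _ _)
      _ ≤ a * ‖X - Y‖ + γ * ‖X - Y‖ * (j * (a * (3 * ‖B‖))) +
          γ * (3 * ‖B‖) * (j * (a * ‖X - Y‖)) := by gcongr
      _ = (a + 2 * (3 * (j * a) * a)) * ‖X - Y‖ := by rw [ha]; ring
      _ ≤ 3 * a * ‖X - Y‖ := by gcongr; linarith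
end

section
/- Let B be a bounded linear operator on X whose matrix is strictly upper triangular, i.e. P_i B P_j = 0 whenever i ≥ j. Then, with no condition on the norm of B, there exists a bounded operator U on X with bounded inverse such that U(D(A)) = D(A) and (A − B)(Ux) = U(Ax) for all x ∈ D(A); that is, A − B is similar to the unperturbed operator A. (Theorem 6.5 of the paper, an application of the hypercausal similarity theorem.) -/
open MeasureTheory Filter Topology AddCircle

section FourierTruncation

variable {T : ℝ} [hT : Fact (0 < T)]

/-- An `L¹` function on the circle can be made arbitrarily small in norm by changing only
Fourier coefficients of bounded index. -/
theorem exists_norm_lt_eventually_fourierCoeff_eq (g : Lp ℂ 1 (@haarAddCircle T hT)) {ε : ℝ}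
    (hε : 0 < ε) :
    ∃ h : Lp ℂ 1 (@haarAddCircle T hT), ‖h‖ < ε ∧
      ∃ N : ℤ, ∀ n ≥ N, fourierCoeff h n = fourierCoeff g n := by
  have hint (f : Lp ℂ 1 (@haarAddCircle T hT)) : Integrable f haarAddCircle := L1.integrable_coeFn f
  have hadd (a b : Lp ℂ 1 (@haarAddCircle T hT)) (n : ℤ) :
      fourierCoeff (a + b : Lp ℂ 1 _) n = fourierCoeff a n + fourierCoeff b n := by
    rw [fourierCoeff_congr_ae (Lp.coeFn_add a b), fourierCoeff.add (hint a) (hint b)]; rfl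
  have hsmul (c : ℂ) (a : Lp ℂ 1 (@haarAddCircle T hT)) (n : ℤ) :
      fourierCoeff (c • a : Lp ℂ 1 _) n = c * fourierCoeff a n := by
    rw [fourierCoeff_congr_ae (Lp.coeFn_smul c a)]
    exact fourierCoeff.const_smul _ _ _
  have hspan : ∀ p ∈ Submodule.span ℂ (Set.range (@fourierLp T _ 1 _)),
      ∃ N : ℤ, ∀ n ≥ N, fourierCoeff p n = 0 := by
    intro p hp
    induction hp using Submodule.span_induction with
    | mem p hp =>
      obtain ⟨m, rfl⟩ := hp
      refine ⟨m + 1, fun n hn => ?_⟩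
      rw [fourierCoeff_congr_ae (coeFn_fourierLp 1 m), fourierCoeff_fourier]
      exact Pi.single_eq_of_ne (by lia) _
    | zero =>
      refine ⟨0, fun n _ => ?_⟩
      simpa using hsmul 0 0 n
    | add p q _ _ hp hq =>
      obtain ⟨M, hM⟩ := hp
      obtain ⟨N, hN⟩ := hq
      refine ⟨max M N, fun n hn => ?_⟩
      rw [hadd, hM n (le_trans (le_max_left _ _) hn), hN n (le_trans (le_max_right _ _) hn),
        add_zero]
    | smul c p _ hp =>
      obtain ⟨M, hM⟩ := hp
      exact ⟨M, fun n hn => by rw [hsmul, hM n hn, mul_zero]⟩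
  have hg : g ∈ (Submodule.span ℂ (Set.range (@fourierLp T _ 1 _))).topologicalClosure := by
    rw [span_fourierLp_closure_eq_top ENNReal.one_ne_top]; trivial
  obtain ⟨p, hp, hgp⟩ := Metric.mem_closure_iff.1 hg ε hε
  obtain ⟨N, hN⟩ := hspan p hp
  refine ⟨g - p, by rwa [← dist_eq_norm], N, fun n hn => ?_⟩
  have := hadd (g - p) p n
  rwa [sub_add_cancel, hN n hn, add_zero, eq_comm] at this

/-- There is an integrable function on the circle with Fourier coefficients `-1/n`. -/
theorem exists_fourierCoeff_eq_neg_inv :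
    ∃ g : Lp ℂ 1 (@haarAddCircle 1 _), ∀ n : ℤ, fourierCoeff g n = -(n : ℂ)⁻¹ := by
  let b : UnitAddCircle → ℂ := fun x => (periodizedBernoulli 1 x : ℂ)
  have hb : MemLp b 1 haarAddCircle := by
    have hm : Measurable (periodizedBernoulli 1) := by
      have hc : Measurable (bernoulliFun 1) := (Polynomial.continuous _).measurable
      exact (hc.comp measurable_subtype_coe).comp (measurableEquivIco (1 : ℝ) 0).measurable
    obtain ⟨C, hC⟩ := (isCompact_Icc (a := (0 : ℝ)) (b := 1)).exists_bound_of_continuousOn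
      (f := bernoulliFun 1) (Polynomial.continuous _).continuousOn
    refine MemLp.of_bound (Complex.measurable_ofReal.comp hm).aestronglyMeasurable C
      (ae_of_all _ fun x => ?_)
    have hx := ((equivIco (1 : ℝ) 0) x).2
    rw [Complex.norm_real]
    exact hC _ ⟨hx.1, by simpa using hx.2.le⟩
  refine ⟨(2 * Real.pi * Complex.I) • hb.toLp b, fun n => ?_⟩
  rw [fourierCoeff_congr_ae (Lp.coeFn_smul _ _)]
  refine (fourierCoeff.const_smul _ _ _).trans ?_
  rw [fourierCoeff_congr_ae hb.coeFn_toLp,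
    show fourierCoeff b n = _ from fourierCoeff_bernoulli_eq one_ne_zero n]
  have hpi : (2 * Real.pi * Complex.I : ℂ) ≠ 0 := Complex.two_pi_I_ne_zero
  rcases eq_or_ne n 0 with rfl | hn
  · simp
  · have : (n : ℂ) ≠ 0 := mod_cast hn
    simp only [smul_eq_mul, Nat.factorial_one, Nat.cast_one, pow_one]
    field_simp

end FourierTruncation

section IsometricResolution

variable {X : Type*} [NormedAddCommGroup X] [NormedSpace ℂ X]

/-- A disjunctive resolution of the identity whose associated periodic group consists of
isometries. -/
structure IsIsometricResolution (P : ℤ → X →L[ℂ] X) : Prop where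
  mul_self (k : ℤ) : P k * P k = P k
  mul_of_ne (i j : ℤ) : i ≠ j → P i * P j = 0
  hasSum (x : X) : HasSum (fun k => P k x) x
  summable (θ : UnitAddCircle) (x : X) : Summable fun k : ℤ => fourier k θ • P k x
  norm_tsum (θ : UnitAddCircle) (x : X) : ‖∑' k : ℤ, fourier k θ • P k x‖ = ‖x‖

/-- The matrix of `Y` with respect to `P` vanishes below the `n`-th superdiagonal. -/
def IsUpper (P : ℤ → X →L[ℂ] X) (n : ℤ) (Y : X →L[ℂ] X) : Prop :=
  ∀ i j : ℤ, j < i + n → P i * Y * P j = 0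

variable {P : ℤ → X →L[ℂ] X}

theorem IsUpper.mono {m n : ℤ} (hmn : m ≤ n) {Y : X →L[ℂ] X} (hY : IsUpper P n Y) :
    IsUpper P m Y :=
  fun i j hij => hY i j (by lia)

theorem IsUpper.of_hasSum {n : ℤ} {u : ℕ → X →L[ℂ] X} {U : X →L[ℂ] X} (hU : HasSum u U)
    (hu : ∀ m, IsUpper P n (u m)) : IsUpper P n U := by
  intro i j hij
  refine ((hU.mul_left (P i)).mul_right (P j)).unique ?_
  convert hasSum_zero using 2 with m
  exact hu m i j hij

namespace IsIsometricResolution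

theorem ext_of_matrix (hP : IsIsometricResolution P) {Y Z : X →L[ℂ] X}
    (h : ∀ i j, P i * Y * P j = P i * Z * P j) : Y = Z := by
  have hij (i j : ℤ) (x : X) : P i (Y (P j x)) = P i (Z (P j x)) :=
    DFunLike.congr_fun (h i j) x
  have hj (j : ℤ) (x : X) : Y (P j x) = Z (P j x) :=
    (hP.hasSum (Y (P j x))).unique <| by
      simpa only [hij] using hP.hasSum (Z (P j x))
  ext x
  refine ((hP.hasSum x).mapL Y).unique ?_
  simpa only [hj] using (hP.hasSum x).mapL Z

/-- Matrix entries of a product are computed by the convergent matrix product. -/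
theorem hasSum_matrix_mul (hP : IsIsometricResolution P) (Y Z : X →L[ℂ] X) (i j : ℤ) (x : X) :
    HasSum (fun k => (P i * Y * P k) ((P k * Z * P j) x)) ((P i * (Y * Z) * P j) x) := by
  have h := (hP.hasSum (Z (P j x))).mapL (P i * Y)
  have hk (k : ℤ) (y : X) : P k (P k y) = P k y := DFunLike.congr_fun (hP.mul_self k) y
  simpa only [mul_apply_eq_comp, hk] using h

theorem isUpper_mul (hP : IsIsometricResolution P) {m n : ℤ} {Y Z : X →L[ℂ] X}
    (hY : IsUpper P m Y) (hZ : IsUpper P n Z) : IsUpper P (m + n) (Y * Z) := by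
  intro i j hij
  ext x
  refine (hP.hasSum_matrix_mul Y Z i j x).unique ?_
  rw [zero_apply]
  convert hasSum_zero using 2 with k
  by_cases hk : k < i + m
  · rw [hY i k hk, zero_apply]
  · rw [hZ k j (by lia), zero_apply, map_zero]

theorem isUpper_one (hP : IsIsometricResolution P) : IsUpper P 0 (1 : X →L[ℂ] X) := by
  intro i j hij
  rw [mul_one, hP.mul_of_ne i j (by lia)]

/-- The periodic isometry group `θ ↦ ∑ₖ e^{2πikθ} Pₖ`. -/
noncomputable def rotation (hP : IsIsometricResolution P) (θ : UnitAddCircle) : X →L[ℂ] X :=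
  LinearMap.mkContinuous
    { toFun := fun x => ∑' k : ℤ, fourier k θ • P k x
      map_add' := fun x y => by
        simp only [map_add, smul_add]
        exact (hP.summable θ x).tsum_add (hP.summable θ y)
      map_smul' := fun c x => by
        simp only [map_smul, RingHom.id_apply, smul_comm _ c]
        exact (hP.summable θ x).tsum_const_smul c }
    1 fun x => by simpa using (hP.norm_tsum θ x).le

theorem norm_rotation_apply (hP : IsIsometricResolution P) (θ : UnitAddCircle) (x : X) :
    ‖hP.rotation θ x‖ = ‖x‖ :=
  hP.norm_tsum θ x

theorem hasSum_rotation (hP : IsIsometricResolution P) (θ : UnitAddCircle) (x : X) :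
    HasSum (fun k : ℤ => fourier k θ • P k x) (hP.rotation θ x) :=
  (hP.summable θ x).hasSum

theorem proj_rotation (hP : IsIsometricResolution P) (θ : UnitAddCircle) (i : ℤ) (x : X) :
    P i (hP.rotation θ x) = fourier i θ • P i x := by
  refine ((hP.hasSum_rotation θ x).mapL (P i)).unique ?_
  convert hasSum_single i fun k hk => ?_ using 1
  · rw [map_smul]
    exact congrArg _ (DFunLike.congr_fun (hP.mul_self i) x).symm
  · rw [map_smul]
    have : P i (P k x) = 0 := DFunLike.congr_fun (hP.mul_of_ne i k hk.symm) x
    rw [this, smul_zero]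

theorem rotation_proj (hP : IsIsometricResolution P) (θ : UnitAddCircle) (j : ℤ) (x : X) :
    hP.rotation θ (P j x) = fourier j θ • P j x := by
  refine (hP.hasSum_rotation θ (P j x)).unique ?_
  convert hasSum_single j fun k hk => ?_ using 1
  · exact congrArg _ (DFunLike.congr_fun (hP.mul_self j) x).symm
  · have : P k (P j x) = 0 := DFunLike.congr_fun (hP.mul_of_ne k j hk) x
    rw [this, smul_zero]

theorem continuous_rotation_apply (hP : IsIsometricResolution P) (x : X) :
    Continuous fun θ => hP.rotation θ x := by
  have hlim : TendstoUniformly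
      (fun (s : Finset ℤ) θ => hP.rotation θ (∑ k ∈ s, P k x)) (fun θ => hP.rotation θ x) atTop := by
    rw [Metric.tendstoUniformly_iff]
    intro ε hε
    filter_upwards [Metric.tendsto_nhds.1 (hP.hasSum x) ε hε] with s hs θ
    rwa [dist_eq_norm, ← map_sub, norm_rotation_apply, ← dist_eq_norm, dist_comm]
  refine hlim.continuous (Frequently.of_forall fun s => ?_)
  simp only [map_sum, rotation_proj]
  exact continuous_finsetSum _ fun k _ => (map_continuous (fourier k)).smul continuous_const

theorem continuous_rotation (hP : IsIsometricResolution P) {y : UnitAddCircle → X}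
    (hy : Continuous y) : Continuous fun θ => hP.rotation θ (y θ) := by
  rw [continuous_iff_continuousAt]
  intro a
  have h1 : Tendsto (fun θ => hP.rotation θ (y θ - y a)) (𝓝 a) (𝓝 0) := by
    rw [tendsto_zero_iff_norm_tendsto_zero]
    simp only [norm_rotation_apply]
    exact tendsto_iff_norm_sub_tendsto_zero.1 hy.continuousAt
  have h2 := h1.add (hP.continuous_rotation_apply (y a)).continuousAt
  simpa only [← map_add, sub_add_cancel, zero_add, ContinuousAt] using h2

/-- Fourier multipliers along the diagonals of operator matrices given by `L¹` functions. -/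
theorem exists_multiplier [CompleteSpace X] (hP : IsIsometricResolution P)
    (f : Lp ℂ 1 (@haarAddCircle 1 _)) (Y : X →L[ℂ] X) :
    ∃ Z : X →L[ℂ] X, ‖Z‖ ≤ ‖f‖ * ‖Y‖ ∧
      ∀ i j, P i * Z * P j = fourierCoeff f (j - i) • (P i * Y * P j) := by
  let G (x : X) (θ : UnitAddCircle) : X := hP.rotation θ (Y (hP.rotation (-θ) x))
  have hGc (x : X) : Continuous (G x) :=
    hP.continuous_rotation (Y.continuous.comp ((hP.continuous_rotation_apply x).comp continuous_neg))
  have hGn (x : X) (θ : UnitAddCircle) : ‖G x θ‖ ≤ ‖Y‖ * ‖x‖ := by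
    simp only [G, norm_rotation_apply]
    simpa only [norm_rotation_apply] using Y.le_opNorm (hP.rotation (-θ) x)
  have hf : Integrable f haarAddCircle := L1.integrable_coeFn f
  have hint (x : X) : Integrable (fun θ => f θ • G x θ) haarAddCircle :=
    (hf.norm.mul_const (‖Y‖ * ‖x‖)).mono'
      (hf.aestronglyMeasurable.smul (hGc x).aestronglyMeasurable)
      (ae_of_all _ fun θ => by
        rw [norm_smul]
        exact mul_le_mul_of_nonneg_left (hGn x θ) (norm_nonneg _))
  let Z : X →L[ℂ] X := LinearMap.mkContinuous
    { toFun := fun x => ∫ θ, f θ • G x θ ∂haarAddCircle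
      map_add' := fun x y => by
        rw [← integral_add (hint x) (hint y)]
        simp only [G, map_add, smul_add]
      map_smul' := fun c x => by
        rw [RingHom.id_apply, ← integral_smul]
        simp only [G, map_smul, smul_comm _ c] }
    (‖f‖ * ‖Y‖) fun x => by
      refine (norm_integral_le_integral_norm _).trans ?_
      rw [L1.norm_eq_integral_norm, mul_assoc, ← integral_mul_const]
      refine integral_mono (hint x).norm (hf.norm.mul_const _) fun θ => ?_
      simp only [norm_smul]
      exact mul_le_mul_of_nonneg_left (hGn x θ) (norm_nonneg _)
  refine ⟨Z, LinearMap.mkContinuous_norm_le _ (by positivity) _, fun i j => ?_⟩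
  ext x
  have hZ : Z (P j x) = ∫ θ, f θ • G (P j x) θ ∂haarAddCircle := rfl
  simp only [mul_apply_eq_comp, smul_apply]
  rw [hZ, ← (P i).integral_comp_comm (hint _), fourierCoeff, ← integral_smul_const]
  congr 1
  ext θ
  have hneg : fourier j (-θ) = fourier (-j) θ := by simp only [fourier_apply, smul_neg, neg_smul]
  simp only [G, rotation_proj, map_smul, proj_rotation, smul_smul, hneg, smul_eq_mul]
  rw [neg_sub, sub_eq_neg_add, fourier_add]
  congr 1
  ring

/-- The commutator equation `[A, U] = L U` has a unipotent upper triangular solution whenever `L`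
is bounded and raises the order of upper triangular matrices, with no smallness condition. -/
theorem exists_unipotent_commutator [CompleteSpace X] (hP : IsIsometricResolution P)
    (L : (X →L[ℂ] X) →L[ℂ] (X →L[ℂ] X))
    (hL : ∀ n Y, IsUpper P n Y → IsUpper P (n + 1) (L Y)) :
    ∃ U : X →L[ℂ] X, IsUpper P 1 (U - 1) ∧
      ∀ i j : ℤ, ((i : ℂ) - j) • (P i * U * P j) = P i * L U * P j := by
  obtain ⟨g, hg⟩ := exists_fourierCoeff_eq_neg_inv
  choose Γ _ hΓ using hP.exists_multiplier g
  let u : ℕ → X →L[ℂ] X := fun n => n.rec 1 fun _ Y => Γ (L Y)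
  have hu_succ (n : ℕ) : u (n + 1) = Γ (L (u n)) := rfl
  have hu (n : ℕ) : IsUpper P n (u n) := by
    induction n with
    | zero => exact hP.isUpper_one
    | succ n ih =>
      intro i j hij
      rw [hu_succ, hΓ, hL n _ ih i j (by exact_mod_cast hij), smul_zero]
  have hsummable : Summable u := by
    obtain ⟨h, hh, N, hN⟩ :=
      exists_norm_lt_eventually_fourierCoeff_eq g (ε := (2 * (‖L‖ + 1))⁻¹) (by positivity)
    refine summable_of_ratio_norm_eventually_le (r := 1 / 2) (by norm_num) ?_
    filter_upwards [eventually_ge_atTop N.toNat] with n hn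
    obtain ⟨Z, hZ, hZP⟩ := hP.exists_multiplier h (L (u n))
    have hZu : u (n + 1) = Z := by
      refine hP.ext_of_matrix fun i j => ?_
      rw [hu_succ, hΓ, hZP]
      by_cases hij : j < i + (n + 1)
      · rw [hL n _ (hu n) i j hij, smul_zero, smul_zero]
      · rw [hN (j - i) (by lia)]
    rw [hZu]
    calc ‖Z‖ ≤ ‖h‖ * ‖L (u n)‖ := hZ
      _ ≤ (2 * (‖L‖ + 1))⁻¹ * ((‖L‖ + 1) * ‖u n‖) := by
        gcongr
        exact (L.le_opNorm _).trans (by gcongr; linarith)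
      _ = 1 / 2 * ‖u n‖ := by field_simp
  obtain ⟨U, hU⟩ := hsummable
  have hU1 : HasSum (fun n => u (n + 1)) (U - 1) := by
    simpa [u] using (hasSum_nat_add_iff' 1).2 hU
  refine ⟨U, IsUpper.of_hasSum hU1 fun n => (hu (n + 1)).mono (by lia), fun i j => ?_⟩
  have hone : ((i : ℂ) - j) • (P i * 1 * P j) = 0 := by
    rcases eq_or_ne i j with rfl | hij
    · rw [sub_self, zero_smul]
    · rw [mul_one, hP.mul_of_ne i j hij, smul_zero]
  have hUij : ((i : ℂ) - j) • (P i * U * P j) = ((i : ℂ) - j) • (P i * (U - 1) * P j) := by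
    rw [mul_sub, sub_mul, smul_sub, hone, sub_zero]
  rw [hUij]
  refine (((hU1.mul_left (P i)).mul_right (P j)).const_smul ((i : ℂ) - j)).unique ?_
  convert ((hU.mapL L).mul_left (P i)).mul_right (P j) using 2 with n
  rw [hu_succ, hΓ, hg, smul_smul]
  rcases eq_or_ne i j with rfl | hij
  · rw [hL n _ (hu n) i i (by lia), smul_zero]
  · have : (j : ℂ) - i ≠ 0 := sub_ne_zero.2 (mod_cast hij.symm)
    rw [Int.cast_sub, show ((i : ℂ) - j) * -((j : ℂ) - i)⁻¹ = 1 by field_simp; ring, one_smul]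

theorem eq_zero_of_forall_isUpper (hP : IsIsometricResolution P) {Y : X →L[ℂ] X}
    (hY : ∀ n : ℕ, IsUpper P n Y) : Y = 0 := by
  refine hP.ext_of_matrix fun i j => ?_
  rw [hY (j - i + 1).toNat i j (by lia), mul_zero, zero_mul]

theorem eq_zero_of_isIdempotentElem (hP : IsIsometricResolution P) {F : X →L[ℂ] X}
    (hF : F * F = F) (hF1 : IsUpper P 1 F) : F = 0 := by
  refine hP.eq_zero_of_forall_isUpper fun n => ?_
  induction n with
  | zero => exact hF1.mono (by lia)
  | succ n ih =>
    have := hP.isUpper_mul ih hF1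
    rw [hF] at this
    exact_mod_cast this

theorem isUpper_mul_sub_one (hP : IsIsometricResolution P) {U V : X →L[ℂ] X}
    (hU : IsUpper P 1 (U - 1)) (hV : IsUpper P 1 (V - 1)) : IsUpper P 1 (U * V - 1) := by
  have h := hP.isUpper_mul hU hV
  have hUV : U * V - 1 = (U - 1) * (V - 1) + (U - 1) + (V - 1) := by noncomm_ring
  intro i j hij
  rw [hUV, mul_add, mul_add, add_mul, add_mul, h i j (by lia), hU i j hij, hV i j hij]
  simp

theorem exists_inverse_pair [CompleteSpace X] (hP : IsIsometricResolution P) {B : X →L[ℂ] X}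
    (hB : IsUpper P 1 B) :
    ∃ U V : X →L[ℂ] X, U * V = 1 ∧ V * U = 1 ∧
      (∀ i j : ℤ, ((i : ℂ) - j) • (P i * U * P j) = P i * (B * U) * P j) ∧
      ∀ i j : ℤ, ((i : ℂ) - j) • (P i * V * P j) = P i * (-(V * B)) * P j := by
  obtain ⟨U, hU1, hU⟩ := hP.exists_unipotent_commutator (ContinuousLinearMap.mul ℂ _ B)
    fun n Y hY => by
      rw [add_comm]
      exact hP.isUpper_mul hB hY
  obtain ⟨V, hV1, hV⟩ := hP.exists_unipotent_commutator
    (-(ContinuousLinearMap.mul ℂ (X →L[ℂ] X)).flip B) fun n Y hY i j hij => by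
      have := hP.isUpper_mul hY hB i j hij
      simp [this]
  simp only [ContinuousLinearMap.mul_apply', neg_apply,
    ContinuousLinearMap.flip_apply] at hU hV
  have hVU : V * U = 1 := by
    refine sub_eq_zero.1 (hP.ext_of_matrix fun i j => ?_)
    rw [mul_zero, zero_mul]
    rcases eq_or_ne i j with rfl | hij
    · exact hP.isUpper_mul_sub_one hV1 hU1 i i (by lia)
    have hentry : ((i : ℂ) - j) • (P i * (V * U) * P j) = 0 := by
      ext x
      refine ((hP.hasSum_matrix_mul V U i j x).const_smul ((i : ℂ) - j)).unique ?_
      convert (hP.hasSum_matrix_mul (-(V * B)) U i j x).add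
        (hP.hasSum_matrix_mul V (B * U) i j x) using 2 with k
      · rw [← hV, ← hU, smul_apply, smul_apply, map_smul,
          ← add_smul, sub_add_sub_cancel]
      · rw [← add_apply, ← add_mul, ← mul_add]
        simp [mul_assoc]
    have hne : (i : ℂ) - j ≠ 0 := sub_ne_zero.2 (mod_cast hij)
    rw [mul_sub, sub_mul, mul_one, hP.mul_of_ne i j hij, sub_zero]
    exact (smul_eq_zero.1 hentry).resolve_left hne
  refine ⟨U, V, ?_, hVU, hU, hV⟩
  have hidem : (U * V - 1) * (U * V - 1) = -(U * V - 1) := by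
    have : U * V * (U * V) = U * V := by
      rw [mul_assoc, ← mul_assoc V, hVU, one_mul]
    rw [sub_mul, mul_sub, this]
    simp
  have hup := hP.isUpper_mul_sub_one hU1 hV1
  have h0 : -(U * V - 1) = 0 := hP.eq_zero_of_isIdempotentElem (by rw [neg_mul_neg, hidem])
    fun i j hij => by rw [mul_neg, neg_mul, hup i j hij, neg_zero]
  exact sub_eq_zero.1 (neg_eq_zero.1 h0)

/-- An operator `U` satisfying the commutator equation `[A, U] = C` entrywise maps the domain of
`A` to itself, and satisfies `A U x = U A x + C x` there. -/
theorem hasSum_smul_proj_apply (hP : IsIsometricResolution P) {U C : X →L[ℂ] X}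
    (hU : ∀ i j : ℤ, ((i : ℂ) - j) • (P i * U * P j) = P i * C * P j) {x y : X}
    (hx : HasSum (fun k : ℤ => (k : ℂ) • P k x) y) :
    HasSum (fun k : ℤ => (k : ℂ) • P k (U x)) (U y + C x) := by
  convert hP.hasSum (U y + C x) using 2 with i
  refine (((hP.hasSum x).mapL (P i * U)).const_smul (i : ℂ)).unique ?_
  rw [map_add, ← mul_apply_eq_comp (P i) U, ← mul_apply_eq_comp (P i) C]
  convert (hx.mapL (P i * U)).add ((hP.hasSum x).mapL (P i * C)) using 2 with j
  have := DFunLike.congr_fun (hU i j) x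
  simp only [smul_apply, mul_apply_eq_comp] at this
  simp only [mul_apply_eq_comp, map_smul, ← this, sub_smul]
  abel

end IsIsometricResolution
end IsometricResolution

/-- Theorem 6.5 of the paper.  In the setting of a disjunctive resolution of the identity
`(P k)_{k∈ℤ}` on a complex Banach space with isometries `T(t)x = Σ e^{ikt} P_k x` and
`A x = Σ k • P_k x`, if the matrix of `B` is strictly upper triangular
(`P_i B P_j = 0` for `i ≥ j`), then — with no condition on `‖B‖` — the operator
`A − B` is similar to the unperturbed operator `A`. -/
theorem stmt11 {X : Type*} [NormedAddCommGroup X] [NormedSpace ℂ X] [CompleteSpace X]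
    (P : ℤ → X →L[ℂ] X)
    (hidem : ∀ k, (P k).comp (P k) = P k)
    (hdisj : ∀ i j, i ≠ j → (P i).comp (P j) = 0)
    (hsum : ∀ x : X, HasSum (fun k : ℤ => P k x) x)
    (hT : ∀ t : ℝ, ∀ x : X,
      Summable (fun k : ℤ => Complex.exp (Complex.I * k * t) • P k x) ∧
      ‖∑' k : ℤ, Complex.exp (Complex.I * k * t) • P k x‖ = ‖x‖)
    (B : X →L[ℂ] X)
    (hB : ∀ i j : ℤ, j ≤ i → (P i).comp (B.comp (P j)) = 0) :
    ∃ (U V : X →L[ℂ] X),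
      U.comp V = ContinuousLinearMap.id ℂ X ∧
      V.comp U = ContinuousLinearMap.id ℂ X ∧
      (∀ x : X, Summable (fun k : ℤ => (k : ℂ) • P k x) ↔
        Summable (fun k : ℤ => (k : ℂ) • P k (U x))) ∧
      (∀ x : X, Summable (fun k : ℤ => (k : ℂ) • P k x) →
        (∑' k : ℤ, (k : ℂ) • P k (U x)) - B (U x)
          = U (∑' k : ℤ, (k : ℂ) • P k x)) := by
  have hres : IsIsometricResolution P :=
    have key (θ : UnitAddCircle) : ∃ t : ℝ, ∀ k : ℤ,
        fourier k θ = Complex.exp (Complex.I * k * t) := by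
      obtain ⟨s, rfl⟩ := QuotientAddGroup.mk_surjective θ
      refine ⟨2 * Real.pi * s, fun k => ?_⟩
      refine fourier_coe_apply.trans ?_
      congr 1
      push_cast
      ring
    { mul_self := hidem
      mul_of_ne := hdisj
      hasSum := hsum
      summable := fun θ x => by
        obtain ⟨t, ht⟩ := key θ
        simpa only [ht] using (hT t x).1
      norm_tsum := fun θ x => by
        obtain ⟨t, ht⟩ := key θ
        simpa only [ht] using (hT t x).2 }
  have hBup : IsUpper P 1 B := fun i j hij => hB i j (by lia)
  obtain ⟨U, V, hUV, hVU, hU, hV⟩ := hres.exists_inverse_pair hBup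
  refine ⟨U, V, hUV, hVU, fun x => ⟨fun hx => ?_, fun hx => ?_⟩, fun x hx => ?_⟩
  · exact (hres.hasSum_smul_proj_apply hU hx.hasSum).summable
  · have hVUx : V (U x) = x := DFunLike.congr_fun hVU x
    simpa only [hVUx] using (hres.hasSum_smul_proj_apply hV hx.hasSum).summable
  · rw [(hres.hasSum_smul_proj_apply hU hx.hasSum).tsum_eq, mul_apply_eq_comp,
      add_sub_cancel_right]
end
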